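/- Let R > 0, p₀ ∈ ℝ, ε > 0, B > 0, and let θ ∈ S¹ be a fixed unit vector. Let f be a smooth compactly supported function on ℝ³ with support contained in B²_R × ℝ, and suppose that R_C f(θ, p, r) = 0 for all p with |p − p₀| < ε and all r with 0 ≤ r < B. Then ∫_ℝ f(t θ^⊥ + s θ, z) dt = 0 for all (z, s) with |z − p₀|² + (R − s)² < B². -/

import Mathlib

open MeasureTheory Real

noncomputable section

/-- The cylindrical Radon transform `R_C f (θ, p, r)`, where `θ = (cos ϑ, sin ϑ)`
and `θ^⊥ = (-sin ϑ, cos ϑ)`. -/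
def RC (R : ℝ) (f : ℝ × ℝ × ℝ → ℂ) (ϑ p r : ℝ) : ℂ :=
  (1 / (2 * π)) * ∫ t : ℝ, ∫ ψ in (-π)..π,
    f (t * (-Real.sin ϑ) + (R - r * Real.cos ψ) * Real.cos ϑ,
       t * Real.cos ϑ + (R - r * Real.cos ψ) * Real.sin ϑ,
       p + r * Real.sin ψ)

/-- Differentiation under the integral sign over a compact interval, Fréchet version. -/
theorem hasFDerivAt_intervalIntegral_of_continuous {E G : Type*} [NormedAddCommGroup E]
    [NormedSpace ℝ E] [ProperSpace E] [NormedAddCommGroup G] [NormedSpace ℝ G] [CompleteSpace G]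
    {F : E → ℝ → G} {F' : E → ℝ → E →L[ℝ] G} (a b : ℝ)
    (hF : Continuous (Function.uncurry F)) (hF' : Continuous (Function.uncurry F'))
    (hd : ∀ x t, HasFDerivAt (fun x => F x t) (F' x t) x) (x₀ : E) :
    HasFDerivAt (fun x => ∫ t in a..b, F x t) (∫ t in a..b, F' x₀ t) x₀ := by
  obtain ⟨C, hC⟩ := ((isCompact_closedBall x₀ 1).prod
    (isCompact_uIcc (a := a) (b := b))).exists_bound_of_continuousOn hF'.continuousOn
  have hFx : ∀ x, Continuous (F x) := fun x => hF.comp (by fun_prop : Continuous fun t => (x, t))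
  have hFx' : Continuous (F' x₀) := hF'.comp (by fun_prop : Continuous fun t => (x₀, t))
  refine intervalIntegral.hasFDerivAt_integral_of_dominated_of_fderiv_le
    (bound := fun _ => C) (F' := F')
    (Metric.closedBall_mem_nhds x₀ one_pos) (.of_forall fun x => (hFx x).aestronglyMeasurable)
    ((hFx x₀).intervalIntegrable _ _) hFx'.aestronglyMeasurable
    (.of_forall fun t ht x hx => hC (x, t) ⟨hx, Set.uIoc_subset_uIcc ht⟩)
    (by simp) (.of_forall fun t _ x _ => hd x t)

/-- Differentiation under the integral sign over a compact interval, one-variable version. -/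
theorem hasDerivAt_intervalIntegral_of_continuous {G : Type*} [NormedAddCommGroup G]
    [NormedSpace ℝ G] [CompleteSpace G] {F F' : ℝ → ℝ → G} (a b : ℝ)
    (hF : Continuous (Function.uncurry F)) (hF' : Continuous (Function.uncurry F'))
    (hd : ∀ x t, HasDerivAt (fun x => F x t) (F' x t) x) (x₀ : ℝ) :
    HasDerivAt (fun x => ∫ t in a..b, F x t) (∫ t in a..b, F' x₀ t) x₀ := by
  obtain ⟨C, hC⟩ := ((isCompact_closedBall x₀ 1).prod
    (isCompact_uIcc (a := a) (b := b))).exists_bound_of_continuousOn hF'.continuousOn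
  have hFx : ∀ x, Continuous (F x) := fun x => hF.comp (by fun_prop : Continuous fun t => (x, t))
  have hFx' : Continuous (F' x₀) := hF'.comp (by fun_prop : Continuous fun t => (x₀, t))
  exact (intervalIntegral.hasDerivAt_integral_of_dominated_loc_of_deriv_le
    (bound := fun _ => C) (F' := F')
    (Metric.closedBall_mem_nhds x₀ one_pos) (.of_forall fun x => (hFx x).aestronglyMeasurable)
    ((hFx x₀).intervalIntegrable _ _) hFx'.aestronglyMeasurable
    (.of_forall fun t ht x hx => hC (x, t) ⟨hx, Set.uIoc_subset_uIcc ht⟩)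
    (by simp) (.of_forall fun t _ x _ => hd x t)).2

/-- An integral over a compact interval of a `C¹` family is `C¹` in the parameter. -/
theorem contDiff_one_intervalIntegral {E G : Type*} [NormedAddCommGroup E]
    [NormedSpace ℝ E] [ProperSpace E] [NormedAddCommGroup G] [NormedSpace ℝ G] [CompleteSpace G]
    {F : E → ℝ → G} (a b : ℝ) (hF : ContDiff ℝ 1 (Function.uncurry F)) :
    ContDiff ℝ 1 (fun x => ∫ t in a..b, F x t) := by
  set F' : E → ℝ → E →L[ℝ] G := fun x t =>
    (fderiv ℝ (Function.uncurry F) (x, t)).comp (ContinuousLinearMap.inl ℝ E ℝ)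
  have hF'c : Continuous (Function.uncurry F') := by
    have := hF.continuous_fderiv one_ne_zero
    exact this.clm_comp (continuous_const (y := ContinuousLinearMap.inl ℝ E ℝ))
  have hd : ∀ x t, HasFDerivAt (fun x => F x t) (F' x t) x := by
    intro x t
    have h1 : HasFDerivAt (fun y : E => (y, t)) (ContinuousLinearMap.inl ℝ E ℝ) x :=
      hasFDerivAt_prodMk_left x t
    have h2 : HasFDerivAt (Function.uncurry F) (fderiv ℝ (Function.uncurry F) (x, t)) (x, t) :=
      (hF.differentiable one_ne_zero (x, t)).hasFDerivAt
    exact h2.comp x h1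
  have key := hasFDerivAt_intervalIntegral_of_continuous a b hF.continuous hF'c hd
  rw [contDiff_one_iff_hasFDerivAt]
  exact ⟨_, intervalIntegral.continuous_parametric_intervalIntegral_of_continuous' hF'c a b, key⟩

/-- If the means of `h` vanish over all circles of radius less than `B` centered on a vertical
segment, then so do the means of `h` multiplied by the second coordinate. -/
theorem circle_means_snd_mul_eq_zero {h : ℝ × ℝ → ℝ} (hh : ContDiff ℝ 1 h) {p₀ ε B : ℝ}
    (hM : ∀ p r : ℝ, |p - p₀| < ε → 0 ≤ r → r < B →
      ∫ ψ in (-π)..π, h (r * Real.cos ψ, p + r * Real.sin ψ) = 0)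
    (p r : ℝ) (hp : |p - p₀| < ε) (hr : 0 ≤ r) (hrB : r < B) :
    ∫ ψ in (-π)..π, (p + r * Real.sin ψ) * h (r * Real.cos ψ, p + r * Real.sin ψ) = 0 := by
  have hc := hh.continuous
  set hx : ℝ × ℝ → ℝ := fun q => fderiv ℝ h q (1, 0) with hx_def
  set hz : ℝ × ℝ → ℝ := fun q => fderiv ℝ h q (0, 1) with hz_def
  have hxc : Continuous hx := (hh.continuous_fderiv one_ne_zero).clm_apply continuous_const
  have hzc : Continuous hz := (hh.continuous_fderiv one_ne_zero).clm_apply continuous_const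
  have chain : ∀ {a b : ℝ → ℝ} {a' b' u : ℝ}, HasDerivAt a a' u → HasDerivAt b b' u →
      HasDerivAt (fun u => h (a u, b u)) (a' * hx (a u, b u) + b' * hz (a u, b u)) u := by
    intro a b a' b' u ha hb
    have := (hh.differentiable one_ne_zero (a u, b u)).hasFDerivAt.comp_hasDerivAt u
      (ha.prodMk hb)
    refine this.congr_deriv ?_
    have e : ((a', b') : ℝ × ℝ) = a' • (1, 0) + b' • (0, 1) := by simp
    rw [e, map_add, map_smul, map_smul]
    simp [hx_def, hz_def]
  have hz0 : ∀ ρ : ℝ, 0 ≤ ρ → ρ < B →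
      ∫ ψ in (-π)..π, hz (ρ * Real.cos ψ, p + ρ * Real.sin ψ) = 0 := by
    intro ρ h0 h1
    have d := hasDerivAt_intervalIntegral_of_continuous
      (F := fun p ψ => h (ρ * Real.cos ψ, p + ρ * Real.sin ψ))
      (F' := fun p ψ => hz (ρ * Real.cos ψ, p + ρ * Real.sin ψ)) (-π) π
      (by simp only [Function.uncurry_def]; fun_prop)
      (by simp only [Function.uncurry_def]; fun_prop)
      (fun x t => by
        simpa using chain (hasDerivAt_const x (ρ * Real.cos t))
          ((hasDerivAt_id x).add_const (ρ * Real.sin t))) p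
    refine d.unique ((hasDerivAt_const p (0 : ℝ)).congr_of_eventuallyEq ?_)
    have : ∀ᶠ q in nhds p, |q - p₀| < ε :=
      (by fun_prop : Continuous fun q => |q - p₀|).continuousAt.eventually_lt_const hp
    filter_upwards [this] with q hq using hM q ρ hq h0 h1
  have parts : ∀ ρ : ℝ, ∫ ψ in (-π)..π, ((-Real.sin ψ) * h (ρ * Real.cos ψ, p + ρ * Real.sin ψ) +
      Real.cos ψ * ((ρ * -Real.sin ψ) * hx (ρ * Real.cos ψ, p + ρ * Real.sin ψ) +
        (ρ * Real.cos ψ) * hz (ρ * Real.cos ψ, p + ρ * Real.sin ψ))) = 0 := by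
    intro ρ
    rw [intervalIntegral.integral_eq_sub_of_hasDerivAt
      (f := fun ψ => Real.cos ψ * h (ρ * Real.cos ψ, p + ρ * Real.sin ψ))]
    · simp
    · intro ψ _
      exact (Real.hasDerivAt_cos ψ).mul (chain ((Real.hasDerivAt_cos ψ).const_mul ρ)
        (((Real.hasDerivAt_sin ψ).const_mul ρ).const_add p))
    · exact Continuous.intervalIntegrable (by fun_prop) _ _
  set C : ℝ → ℝ := fun ρ =>
    ∫ ψ in (-π)..π, (ρ * Real.sin ψ) * h (ρ * Real.cos ψ, p + ρ * Real.sin ψ) with C_def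
  have hC : ∀ ρ, HasDerivAt C (ρ * ∫ ψ in (-π)..π, hz (ρ * Real.cos ψ, p + ρ * Real.sin ψ)) ρ := by
    intro ρ
    have d := hasDerivAt_intervalIntegral_of_continuous
      (F := fun ρ ψ => (ρ * Real.sin ψ) * h (ρ * Real.cos ψ, p + ρ * Real.sin ψ))
      (F' := fun ρ ψ => Real.sin ψ * h (ρ * Real.cos ψ, p + ρ * Real.sin ψ) +
        (ρ * Real.sin ψ) * (Real.cos ψ * hx (ρ * Real.cos ψ, p + ρ * Real.sin ψ) +
          Real.sin ψ * hz (ρ * Real.cos ψ, p + ρ * Real.sin ψ))) (-π) π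
      (by simp only [Function.uncurry_def]; fun_prop)
      (by simp only [Function.uncurry_def]; fun_prop)
      (fun x t => by
        have h1 : HasDerivAt (fun x : ℝ => x * Real.sin t) (Real.sin t) x := by
          simpa using (hasDerivAt_id x).mul_const (Real.sin t)
        have h2 : HasDerivAt (fun x : ℝ => x * Real.cos t) (Real.cos t) x := by
          simpa using (hasDerivAt_id x).mul_const (Real.cos t)
        exact h1.mul (chain h2 (h1.const_add p))) ρ
    refine d.congr_deriv ?_
    rw [← add_zero (∫ ψ in (-π)..π, _), ← parts ρ, ← intervalIntegral.integral_add,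
      ← intervalIntegral.integral_const_mul]
    · refine intervalIntegral.integral_congr fun ψ _ => ?_
      linear_combination (ρ * hz (ρ * Real.cos ψ, p + ρ * Real.sin ψ)) *
        Real.sin_sq_add_cos_sq ψ
    · exact Continuous.intervalIntegrable (by fun_prop) _ _
    · exact Continuous.intervalIntegrable (by fun_prop) _ _
  have hC0 : C r = 0 := by
    have := constant_of_has_deriv_right_zero (f := C) (a := 0) (b := r)
      (fun x _ => (hC x).continuousAt.continuousWithinAt)
      (fun x hx => by
        have := (hC x).hasDerivWithinAt (s := Set.Ici x)
        rwa [hz0 x hx.1 (hx.2.trans hrB), mul_zero] at this) r ⟨hr, le_rfl⟩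
    rw [this]
    simp [C_def]
  simp only [add_mul]
  rw [intervalIntegral.integral_add (Continuous.intervalIntegrable (by fun_prop) _ _)
    (Continuous.intervalIntegrable (by fun_prop) _ _), intervalIntegral.integral_const_mul,
    hM p r hp hr hrB]
  simpa [C_def] using hC0

/-- If the means of `h` vanish over all circles of radius less than `B` centered on a vertical
segment, then so do the means of `h` multiplied by a polynomial in the second coordinate. -/
theorem circle_means_polynomial_mul_eq_zero {h : ℝ × ℝ → ℝ} (hh : ContDiff ℝ 1 h) {p₀ ε B : ℝ}
    (hM : ∀ p r : ℝ, |p - p₀| < ε → 0 ≤ r → r < B →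
      ∫ ψ in (-π)..π, h (r * Real.cos ψ, p + r * Real.sin ψ) = 0)
    (P : Polynomial ℝ) (p r : ℝ) (hp : |p - p₀| < ε) (hr : 0 ≤ r) (hrB : r < B) :
    ∫ ψ in (-π)..π, P.eval (p + r * Real.sin ψ) * h (r * Real.cos ψ, p + r * Real.sin ψ) = 0 := by
  have hc := hh.continuous
  have pow : ∀ n : ℕ, ∀ p r : ℝ, |p - p₀| < ε → 0 ≤ r → r < B → ∫ ψ in (-π)..π,
      (p + r * Real.sin ψ) ^ n * h (r * Real.cos ψ, p + r * Real.sin ψ) = 0 := by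
    intro n
    induction n with
    | zero => simpa using hM
    | succ n ih =>
      intro p r hp hr hrB
      have hn : ContDiff ℝ 1 fun q : ℝ × ℝ => q.2 ^ n * h q := by fun_prop
      simpa [pow_succ', mul_assoc] using circle_means_snd_mul_eq_zero hn ih p r hp hr hrB
  induction P using Polynomial.induction_on' with
  | add P Q hP hQ =>
    simp only [Polynomial.eval_add, add_mul]
    rw [intervalIntegral.integral_add (Continuous.intervalIntegrable (by fun_prop) _ _)
      (Continuous.intervalIntegrable (by fun_prop) _ _), hP, hQ, add_zero]
  | monomial n a =>
    simp only [Polynomial.eval_monomial, mul_assoc]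
    rw [intervalIntegral.integral_const_mul, pow n p r hp hr hrB, mul_zero]

/-- A `C¹` function vanishing on the left half-plane whose means vanish over all circles of radius
less than `B` centered near `(0, p₀)` on the vertical axis vanishes on the disc of radius `B`
about `(0, p₀)`. -/
theorem eq_zero_of_circle_means_eq_zero {h : ℝ × ℝ → ℝ} (hh : ContDiff ℝ 1 h) {p₀ ε B : ℝ}
    (hε : 0 < ε) (hleft : ∀ x z : ℝ, x ≤ 0 → h (x, z) = 0)
    (hM : ∀ p r : ℝ, |p - p₀| < ε → 0 ≤ r → r < B →
      ∫ ψ in (-π)..π, h (r * Real.cos ψ, p + r * Real.sin ψ) = 0)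
    (hB : 0 ≤ B) (x z : ℝ) (hxz : x ^ 2 + (z - p₀) ^ 2 < B ^ 2) : h (x, z) = 0 := by
  have hc := hh.continuous
  set c : ℂ := ⟨x, z - p₀⟩ with c_def
  set r : ℝ := ‖c‖ with r_def
  have hr : 0 ≤ r := norm_nonneg _
  have hrsq : r ^ 2 = x ^ 2 + (z - p₀) ^ 2 := by
    rw [r_def, Complex.sq_norm, Complex.normSq_mk]; ring
  have hrB : r < B := lt_of_pow_lt_pow_left₀ 2 hB (by rw [hrsq]; exact hxz)
  have hcos : r * Real.cos c.arg = x := Complex.norm_mul_cos_arg c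
  have hsin : r * Real.sin c.arg = z - p₀ := Complex.norm_mul_sin_arg c
  set w : ℝ → ℝ := fun ψ => h (r * Real.cos ψ, p₀ + r * Real.sin ψ) with w_def
  have hw : Continuous w := by fun_prop
  set v : ℝ → ℝ := fun y => h (√(r ^ 2 - (y - p₀) ^ 2), y) with v_def
  have hv : Continuous v := by fun_prop
  have hvw : ∀ ψ, v (p₀ + r * Real.sin ψ) * w ψ = w ψ * w ψ := by
    intro ψ
    rcases le_total (r * Real.cos ψ) 0 with hψ | hψ
    · have : w ψ = 0 := hleft _ _ hψ
      simp [this]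
    · have : √(r ^ 2 - (p₀ + r * Real.sin ψ - p₀) ^ 2) = r * Real.cos ψ := by
        rw [← Real.sqrt_sq hψ]
        congr 1
        linear_combination (-r ^ 2) * Real.sin_sq_add_cos_sq ψ
      simp only [v_def, w_def, this]
  obtain ⟨K, hK⟩ := (isCompact_Icc (a := -π) (b := π)).exists_bound_of_continuousOn hw.continuousOn
  have hI0 : 0 ≤ ∫ ψ in (-π)..π, w ψ * w ψ :=
    intervalIntegral.integral_nonneg (by linarith [Real.pi_pos]) fun ψ _ => mul_self_nonneg _
  have hI : ∫ ψ in (-π)..π, w ψ * w ψ = 0 := by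
    refine le_antisymm (le_of_forall_pos_le_add fun δ hδ => ?_) hI0
    have hπ := Real.pi_pos
    have hK0 : 0 ≤ K := (norm_nonneg _).trans (hK 0 ⟨by linarith, hπ.le⟩)
    obtain ⟨P, hP⟩ := exists_polynomial_near_of_continuousOn (p₀ - r) (p₀ + r) v hv.continuousOn
      (δ / ((K + 1) * (2 * π))) (by positivity)
    have e : ∫ ψ in (-π)..π, w ψ * w ψ =
        ∫ ψ in (-π)..π, (w ψ * w ψ - P.eval (p₀ + r * Real.sin ψ) * w ψ) := by
      rw [intervalIntegral.integral_sub (Continuous.intervalIntegrable (by fun_prop) _ _)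
        (Continuous.intervalIntegrable (by fun_prop) _ _),
        circle_means_polynomial_mul_eq_zero hh hM P p₀ r (by simpa using hε) hr hrB, sub_zero]
    have hb := intervalIntegral.norm_integral_le_of_norm_le_const (a := -π) (b := π)
      (f := fun ψ => w ψ * w ψ - P.eval (p₀ + r * Real.sin ψ) * w ψ)
      (C := δ / ((K + 1) * (2 * π)) * (K + 1)) (fun ψ hψ => by
        rw [Set.uIoc_of_le (by linarith)] at hψ
        have h1 := hK ψ ⟨hψ.1.le, hψ.2⟩
        have h2 := hP (p₀ + r * Real.sin ψ) ⟨by nlinarith [Real.neg_one_le_sin ψ],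
          by nlinarith [Real.sin_le_one ψ]⟩
        rw [← hvw, ← sub_mul, norm_mul, Real.norm_eq_abs, abs_sub_comm]
        exact mul_le_mul h2.le (h1.trans (by linarith)) (norm_nonneg _) (by positivity))
    rw [← e, abs_of_pos (by linarith : 0 < π - -π)] at hb
    have : δ / ((K + 1) * (2 * π)) * (K + 1) * (π - -π) = δ := by
      field_simp
      ring
    rw [this] at hb
    linarith [Real.le_norm_self (∫ ψ in (-π)..π, w ψ * w ψ)]
  by_contra hne
  have hwa : w c.arg ≠ 0 := by
    simpa only [w_def, hcos, hsin, add_sub_cancel] using hne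
  refine (intervalIntegral.integral_pos (a := -π) (b := π) (f := fun ψ => w ψ * w ψ)
    (by linarith [Real.pi_pos]) (by fun_prop) (fun ψ _ => mul_self_nonneg _)
    ⟨c.arg, ⟨(Complex.neg_pi_lt_arg c).le, Complex.arg_le_pi c⟩, ?_⟩).ne' hI
  exact mul_self_pos.2 hwa

/-- Fubini for continuous functions on a rectangle. -/
theorem intervalIntegral_integral_swap_of_continuous {G : Type*} [NormedAddCommGroup G]
    [NormedSpace ℝ G] {F : ℝ → ℝ → G} {a b c d : ℝ}
    (hF : Continuous fun q : ℝ × ℝ => F q.1 q.2) :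
    ∫ x in a..b, ∫ y in c..d, F x y = ∫ y in c..d, ∫ x in a..b, F x y := by
  refine intervalIntegral_intervalIntegral_swap ?_
  exact (hF.continuousOn.integrableOn_compact
    (isCompact_uIcc.prod isCompact_uIcc)).mono_set
    (Set.prod_mono Set.uIoc_subset_uIcc Set.uIoc_subset_uIcc)

/-- Support lemma: if `R_C f (θ, p, r) = 0` for `|p - p₀| < ε` and `0 ≤ r < B`, then the planar
Radon transform `∫ f(t θ^⊥ + s θ, z) dt` vanishes for `|z - p₀|² + (R - s)² < B²`. -/
theorem support_lemma_cylindrical (R : ℝ) (hR : 0 < R) (p₀ ε B : ℝ)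
    (hε : 0 < ε) (hB : 0 < B) (ϑ : ℝ) (f : ℝ × ℝ × ℝ → ℂ)
    (hf : ContDiff ℝ (⊤ : ℕ∞) f) (hfc : HasCompactSupport f)
    (hsupp : ∀ x y z : ℝ, f (x, y, z) ≠ 0 → x ^ 2 + y ^ 2 < R ^ 2)
    (hzero : ∀ p r : ℝ, |p - p₀| < ε → 0 ≤ r → r < B → RC R f ϑ p r = 0)
    (z s : ℝ) (hzs : |z - p₀| ^ 2 + (R - s) ^ 2 < B ^ 2) :
    (∫ t : ℝ, f (t * (-Real.sin ϑ) + s * Real.cos ϑ,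
                 t * Real.cos ϑ + s * Real.sin ϑ, z)) = 0 := by
  have hfc' := hf.continuous
  have hvan : ∀ t σ ζ : ℝ, R ^ 2 ≤ t ^ 2 + σ ^ 2 →
      f (t * (-Real.sin ϑ) + σ * Real.cos ϑ, t * Real.cos ϑ + σ * Real.sin ϑ, ζ) = 0 := by
    intro t σ ζ h
    by_contra hne
    have := hsupp _ _ _ hne
    nlinarith [Real.sin_sq_add_cos_sq ϑ,
      congrArg (fun u => (t ^ 2 + σ ^ 2) * u) (Real.sin_sq_add_cos_sq ϑ)]
  have hline : ∀ σ ζ : ℝ,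
      (∫ t : ℝ, f (t * (-Real.sin ϑ) + σ * Real.cos ϑ, t * Real.cos ϑ + σ * Real.sin ϑ, ζ)) =
      ∫ t in (-R)..R,
        f (t * (-Real.sin ϑ) + σ * Real.cos ϑ, t * Real.cos ϑ + σ * Real.sin ϑ, ζ) := by
    intro σ ζ
    refine (intervalIntegral.integral_eq_integral_of_support_subset fun t ht => ?_).symm
    by_contra hn
    refine ht (hvan t σ ζ ?_)
    rw [Set.mem_Ioc, not_and_or, not_lt, not_le] at hn
    rcases hn with hn | hn <;> nlinarith [sq_nonneg σ]
  set g : ℝ × ℝ → ℂ := fun q => ∫ t in (-R)..R, f (t * (-Real.sin ϑ) + (R - q.1) * Real.cos ϑ,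
    t * Real.cos ϑ + (R - q.1) * Real.sin ϑ, q.2) with g_def
  have hg : ContDiff ℝ 1 g := by
    refine contDiff_one_intervalIntegral _ _ ?_
    have hf1 : ContDiff ℝ 1 f := hf.of_le (by exact_mod_cast le_top)
    simp only [Function.uncurry_def]
    fun_prop
  have hleft : ∀ x ζ : ℝ, x ≤ 0 → g (x, ζ) = 0 := by
    intro x ζ hx
    simp only [g_def]
    rw [← hline]
    exact integral_eq_zero_of_ae (.of_forall fun t => hvan t _ _ (by nlinarith [sq_nonneg t]))
  have hmean : ∀ p r : ℝ, |p - p₀| < ε → 0 ≤ r → r < B →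
      ∫ ψ in (-π)..π, g (r * Real.cos ψ, p + r * Real.sin ψ) = 0 := by
    intro p r hp hr hrB
    have h0 := hzero p r hp hr hrB
    rw [RC, mul_eq_zero] at h0
    replace h0 := h0.resolve_left (by simp [Real.pi_ne_zero])
    rw [← h0]
    have hout : (∫ t : ℝ, ∫ ψ in (-π)..π, f (t * (-Real.sin ϑ) + (R - r * Real.cos ψ) * Real.cos ϑ,
        t * Real.cos ϑ + (R - r * Real.cos ψ) * Real.sin ϑ, p + r * Real.sin ψ)) =
        ∫ t in (-R)..R, ∫ ψ in (-π)..π, f (t * (-Real.sin ϑ) + (R - r * Real.cos ψ) * Real.cos ϑ,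
        t * Real.cos ϑ + (R - r * Real.cos ψ) * Real.sin ϑ, p + r * Real.sin ψ) := by
      refine (intervalIntegral.integral_eq_integral_of_support_subset fun t ht => ?_).symm
      by_contra hn
      refine ht ?_
      rw [Set.mem_Ioc, not_and_or, not_lt, not_le] at hn
      refine intervalIntegral.integral_zero_ae (.of_forall fun ψ _ => hvan t _ _ ?_)
      rcases hn with hn | hn <;> nlinarith [sq_nonneg (R - r * Real.cos ψ)]
    rw [hout]
    exact intervalIntegral_integral_swap_of_continuous (by fun_prop)
  have hgc := hg.continuous
  have hzero_g : g (R - s, z) = 0 := by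
    have hxz : (R - s) ^ 2 + (z - p₀) ^ 2 < B ^ 2 := by rw [← sq_abs (z - p₀)]; linarith
    have hint : ∀ p r : ℝ, IntervalIntegrable
        (fun ψ => g (r * Real.cos ψ, p + r * Real.sin ψ)) volume (-π) π :=
      fun p r => Continuous.intervalIntegrable (by fun_prop) _ _
    refine Complex.ext
      (eq_zero_of_circle_means_eq_zero (h := fun q => Complex.reCLM (g q))
        (Complex.reCLM.contDiff.comp hg) hε (fun x ζ hx => by simp [hleft x ζ hx])
        (fun p r hp hr hrB => ?_) hB.le _ _ hxz)
      (eq_zero_of_circle_means_eq_zero (h := fun q => Complex.imCLM (g q))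
        (Complex.imCLM.contDiff.comp hg) hε (fun x ζ hx => by simp [hleft x ζ hx])
        (fun p r hp hr hrB => ?_) hB.le _ _ hxz)
    · rw [ContinuousLinearMap.intervalIntegral_comp_comm _ (hint p r), hmean p r hp hr hrB, map_zero]
    · rw [ContinuousLinearMap.intervalIntegral_comp_comm _ (hint p r), hmean p r hp hr hrB, map_zero]
  rw [hline]
  simpa [g_def] using hzero_g
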